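/- Let n = 4m and h : ZMod n → {1, -1} satisfy ∑_j h(j) h(j - s) = 0 for all s ≠ 0. Then the number of 1-blocks of h (maximal constant runs of length exactly 1, i.e. indices j with h(j-1) ≠ h(j) and h(j) ≠ h(j+1)) equals m. -/

import Mathlib

open Finset
open scoped Classical

/-- `h` is a `±1` vector. -/
def signRow (n : ℕ) (h : ZMod n → ℤ) : Prop := ∀ j, h j = 1 ∨ h j = -1

/-- All nontrivial circular autocorrelations of `h` vanish: `h` is the defining
row of a circulant Hadamard matrix. -/
def hadamardRow (n : ℕ) [NeZero n] (h : ZMod n → ℤ) : Prop :=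
  ∀ s : ZMod n, s ≠ 0 → ∑ j : ZMod n, h j * h (j - s) = 0

/-- `j` is the first index of a maximal (cyclic) constant block of `h`. -/
def isStart (n : ℕ) (h : ZMod n → ℤ) (j : ZMod n) : Prop := h j ≠ h (j - 1)

/-- The length of the maximal constant run of `h` beginning at `j`. -/
noncomputable def blockLen (n : ℕ) (h : ZMod n → ℤ) (j : ZMod n) : ℕ :=
  sInf {k : ℕ | 0 < k ∧ h (j + (k : ZMod n)) ≠ h j}

/-- `j` is (the position of) a block of size exactly 1. -/
def oneBlock (n : ℕ) (h : ZMod n → ℤ) (j : ZMod n) : Prop :=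
  h j ≠ h (j - 1) ∧ h j ≠ h (j + 1)

/-- `j` starts a block of size exactly 2. -/
def twoBlock (n : ℕ) (h : ZMod n → ℤ) (j : ZMod n) : Prop :=
  h j ≠ h (j - 1) ∧ h j = h (j + 1) ∧ h (j + 1) ≠ h (j + 2)

/-- `j` starts a block of size at least 3. -/
def bigBlock (n : ℕ) (h : ZMod n → ℤ) (j : ZMod n) : Prop :=
  h j ≠ h (j - 1) ∧ h j = h (j + 1) ∧ h (j + 1) = h (j + 2)

/-- The block ending at `j - 1` has size exactly 2. -/
def prevTwo (n : ℕ) (h : ZMod n → ℤ) (j : ZMod n) : Prop :=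
  h (j - 1) = h (j - 2) ∧ h (j - 2) ≠ h (j - 3)

/-- The block ending at `j - 1` has size at least 3. -/
def prevBig (n : ℕ) (h : ZMod n → ℤ) (j : ZMod n) : Prop :=
  h (j - 1) = h (j - 2) ∧ h (j - 2) = h (j - 3)

/-- `j` is the first 1-block of a maximal run of consecutive 1-blocks
(a `1`-alternating sequence). -/
def oneRunStart (n : ℕ) (h : ZMod n → ℤ) (j : ZMod n) : Prop :=
  oneBlock n h j ∧ ¬ oneBlock n h (j - 1)

/-- `j` starts the first 2-block of a maximal run of consecutive 2-blocks
(a `2`-alternating sequence). -/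
def twoRunStart (n : ℕ) (h : ZMod n → ℤ) (j : ZMod n) : Prop :=
  twoBlock n h j ∧ ¬ twoBlock n h (j - 2)

/-- `j` starts the first block of a maximal run of consecutive blocks of size `≥ 3`. -/
def bigRunStart (n : ℕ) (h : ZMod n → ℤ) (j : ZMod n) : Prop :=
  bigBlock n h j ∧ ¬ prevBig n h j

/-- The number `α₁` of maximal runs of consecutive 1-blocks. -/
noncomputable def alpha1 (n : ℕ) [NeZero n] (h : ZMod n → ℤ) : ℕ :=
  (Finset.univ.filter fun j => oneRunStart n h j).card

/-- The length (number of 1-blocks) of the maximal run of 1-blocks starting at `j`. -/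
noncomputable def oneRunLen (n : ℕ) (h : ZMod n → ℤ) (j : ZMod n) : ℕ :=
  sInf {l : ℕ | 0 < l ∧ ¬ oneBlock n h (j + (l : ZMod n))}

/-- The length (number of 2-blocks) of the maximal run of 2-blocks starting at `j`. -/
noncomputable def twoRunLen (n : ℕ) (h : ZMod n → ℤ) (j : ZMod n) : ℕ :=
  sInf {l : ℕ | 0 < l ∧ ¬ twoBlock n h (j + ((2 * l : ℕ) : ZMod n))}


/-- Four times the indicator of a sign change on both sides of `b`, as a polynomial in signs. -/
theorem four_mul_indicator_isolated_sign {a b c : ℤ} (ha : a = 1 ∨ a = -1)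
    (hb : b = 1 ∨ b = -1) (hc : c = 1 ∨ c = -1) :
    4 * (if a ≠ b ∧ b ≠ c then (1 : ℤ) else 0) = 1 - b * a - c * b + c * a := by
  rcases ha with rfl | rfl <;> rcases hb with rfl | rfl <;> rcases hc with rfl | rfl <;> norm_num

/-- For a row with vanishing autocorrelations, products at two positions a fixed nonzero
distance apart sum to zero. -/
theorem hadamardRow.sum_translate_mul {n : ℕ} [NeZero n] {h : ZMod n → ℤ}
    (hH : hadamardRow n h) {s : ZMod n} (hs : s ≠ 0) (t : ZMod n) :
    ∑ j : ZMod n, h (j + t) * h (j + t - s) = 0 :=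
  (Equiv.sum_comp (Equiv.addRight t) fun j => h j * h (j - s)).trans (hH s hs)

theorem stmt1 (n m : ℕ) [NeZero n] (h : ZMod n → ℤ)
    (hn : n = 4 * m) (hm : 1 ≤ m)
    (hsign : signRow n h) (hH : hadamardRow n h) :
    (Finset.univ.filter fun j : ZMod n => h (j - 1) ≠ h j ∧ h j ≠ h (j + 1)).card = m := by
  have one_ne : (1 : ZMod n) ≠ 0 := by
    intro h0
    have hdvd : n ∣ 1 := (ZMod.natCast_eq_zero_iff 1 n).mp (by exact_mod_cast h0)
    have := Nat.le_of_dvd one_pos hdvd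
    omega
  have two_ne : (2 : ZMod n) ≠ 0 := by
    intro h0
    have hdvd : n ∣ 2 := (ZMod.natCast_eq_zero_iff 2 n).mp (by exact_mod_cast h0)
    have := Nat.le_of_dvd two_pos hdvd
    omega
  have sum_prev := hH 1 one_ne
  have sum_next : ∑ j : ZMod n, h (j + 1) * h j = 0 := by
    simpa using hH.sum_translate_mul one_ne 1
  have sum_outer : ∑ j : ZMod n, h (j + 1) * h (j - 1) = 0 := by
    have hsub (j : ZMod n) : j + 1 - 2 = j - 1 := by ring
    simpa only [hsub] using hH.sum_translate_mul two_ne 1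
  have key : 4 * ((Finset.univ.filter
      fun j : ZMod n => h (j - 1) ≠ h j ∧ h j ≠ h (j + 1)).card : ℤ) = n := by
    rw [Finset.natCast_card_filter, Finset.mul_sum]
    calc
      _ = ∑ j : ZMod n, (1 - h j * h (j - 1) - h (j + 1) * h j + h (j + 1) * h (j - 1)) :=
        Finset.sum_congr rfl fun j _ =>
          four_mul_indicator_isolated_sign (hsign (j - 1)) (hsign j) (hsign (j + 1))
      _ = n := by
        simp [Finset.sum_add_distrib, Finset.sum_sub_distrib, sum_prev, sum_next, sum_outer,
          ZMod.card]
  omega
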